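/- arXiv:2406.16834 — 2 statements merged into one kernel-verified Lean document; each statement's English description precedes it below -/
import Mathlib

section
/- Let 0 ≤ a < 1 < b ≤ ∞, let f : (a,b) → ℝ be convex with f(1) = 0, let P be a probability measure on a measurable space X, and let h : X → ℝ be bounded and measurable with α ≤ h ≤ β for real numbers α ≤ β. Then α ≤ Λ_f^P[h] ≤ β, where Λ_f^P[h] := inf_{ν∈ℝ} { ν + E_P[f*(h−ν)] } and f* is the Legendre transform of f. -/
open MeasureTheory Set Filter Topology
open scoped ENNReal NNReal Classical

noncomputable section

/-- The interval `(a, b)` with `b` possibly infinite. -/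
def Dom (a : ℝ) (b : EReal) : Set ℝ := {t : ℝ | a < t ∧ (t : EReal) < b}

/-- Legendre transform of `f` on `(a,b)`, with values in `(-∞, ∞]` (modeled by `EReal`). -/
def fStar (f : ℝ → ℝ) (a : ℝ) (b : EReal) (z : ℝ) : EReal :=
  ⨆ t ∈ Dom a b, ((z * t - f t : ℝ) : EReal)

/-- Real-valued version of the Legendre transform (junk value where it is `⊤`). -/
def fStarR (f : ℝ → ℝ) (a : ℝ) (b : EReal) (z : ℝ) : ℝ := (fStar f a b z).toReal

/-- Right derivative of `g` at `z`. -/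
def rderiv (g : ℝ → ℝ) (z : ℝ) : ℝ := derivWithin g (Ici z) z

/-- `z₀ := f'_+(1)`. -/
def zz (f : ℝ → ℝ) : ℝ := rderiv f 1

/-- Integral of an `EReal`-valued function: the Bochner integral if the function is
a.e. finite and integrable, and `⊤` otherwise. -/
def eIntegral {X : Type*} [MeasurableSpace X] (P : Measure X) (g : X → EReal) : EReal :=
  if (∀ᵐ x ∂P, g x ≠ ⊤) ∧ Integrable (fun x => (g x).toReal) P
  then ((∫ x, (g x).toReal ∂P : ℝ) : EReal) else ⊤

/-- The generalized cumulant generating function `Λ_f^P[h]`. -/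
def cgf {X : Type*} [MeasurableSpace X] (f : ℝ → ℝ) (a : ℝ) (b : EReal)
    (P : Measure X) (h : X → ℝ) : EReal :=
  ⨅ ν : ℝ, ((ν : EReal) + eIntegral P (fun x => fStar f a b (h x - ν)))

/-- Real-valued `Λ_f^P[h]`. -/
def cgfR {X : Type*} [MeasurableSpace X] (f : ℝ → ℝ) (a : ℝ) (b : EReal)
    (P : Measure X) (h : X → ℝ) : ℝ := (cgf f a b P h).toReal

/-- `Λ_f : ℝⁿ → ℝ` (with values in `EReal`). -/
def lamVec (f : ℝ → ℝ) (a : ℝ) (b : EReal) {n : ℕ} (x : Fin n → ℝ) : EReal :=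
  ⨅ ν : ℝ, ((ν : EReal) + ((n : ℝ)⁻¹ : EReal) * ∑ i, fStar f a b (x i - ν))

/-- Empirical measure of `n` points. -/
def empMeas {X : Type*} [MeasurableSpace X] (n : ℕ) (xs : Fin n → X) : Measure X :=
  (n : ℝ≥0∞)⁻¹ • ∑ i, Measure.dirac (xs i)

/-- The `(f,Γ)`-divergence `D_f^Γ(Q‖P)`. -/
def Dfg {X : Type*} [MeasurableSpace X] (f : ℝ → ℝ) (a : ℝ) (b : EReal)
    (Γ : Set (X → ℝ)) (Q P : Measure X) : ℝ :=
  sSup {r : ℝ | ∃ h ∈ Γ, r = ∫ x, h x ∂Q - cgfR f a b P h}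

/-- Empirical Rademacher complexity of `Ψ` at the sample `y`. -/
def empRad {Y : Type*} (Ψ : Set (Y → ℝ)) (n : ℕ) (y : Fin n → Y) : ℝ :=
  (2 ^ n : ℝ)⁻¹ * ∑ σ : Fin n → Bool,
    sSup {r : ℝ | ∃ ψ ∈ Ψ, r = (n : ℝ)⁻¹ * ∑ i, (if σ i then 1 else -1) * ψ (y i)}

/-- Rademacher complexity of `Ψ` relative to `P` with `n` samples. -/
def rad {Y : Type*} [MeasurableSpace Y] (Ψ : Set (Y → ℝ)) (P : Measure Y) (n : ℕ) : ℝ :=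
  ∫ y, empRad Ψ n y ∂(Measure.pi fun _ : Fin n => P)

/-- `Δ_{f,n}`. -/
def Δq (f : ℝ → ℝ) (a : ℝ) (b : EReal) (α β : ℝ) (n : ℕ) : ℝ :=
  sInf ((fun z => (n : ℝ) * (-z + (((n : ℝ) - 1) / (n : ℝ)) * fStarR f a b z
      + (1 / (n : ℝ)) * fStarR f a b (β - α + z))) '' Icc (zz f - (β - α)) (zz f))

/-- `sup_{h ∈ Γ} inf_{h̃ ∈ Γ̃} ‖h − h̃‖_∞`. -/
def approxErr {X : Type*} (Γ Γt : Set (X → ℝ)) : ℝ :=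
  sSup {r : ℝ | ∃ h ∈ Γ, r = sInf {s : ℝ | ∃ ht ∈ Γt, s = ⨆ x, |h x - ht x|}}

/-- A countable subset which is pointwise-limit dense. -/
def PtwiseDenseCount {X : Type*} (Γ : Set (X → ℝ)) : Prop :=
  ∃ Γ₀ ⊆ Γ, Γ₀.Countable ∧ ∀ h ∈ Γ, ∃ s : ℕ → X → ℝ,
    (∀ j, s j ∈ Γ₀) ∧ ∀ x, Tendsto (fun j => s j x) atTop (𝓝 (h x))

/-- The quantity `K_{f,Ψ,P,n}` from Definition 3.4: either `(f*)'_+` is Lipschitz on the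
relevant interval and `Ψ` contains a constant, in which case `K` is the minimum of the two
expressions, or `K` is the second expression. -/
def Kchoice (f : ℝ → ℝ) (a : ℝ) (b : EReal) (α β : ℝ) {Y : Type*} [MeasurableSpace Y]
    (Ψ : Set (Y → ℝ)) (P : Measure Y) (n : ℕ) (K : ℝ) : Prop :=
  (∃ L : ℝ≥0, LipschitzOnWith L (rderiv (fStarR f a b))
      (Icc (zz f - (β - α)) (zz f + (β - α))) ∧
    (∃ c : ℝ, (fun _ => c) ∈ Ψ) ∧
    K = min ((1 + 2 * (β - α) * (L : ℝ)) * rad Ψ P n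
        + (β - α) ^ 2 * (L : ℝ) / (2 * Real.sqrt n))
      (rderiv (fStarR f a b) (β - α + zz f) * (rad Ψ P n + (β - α) / (2 * Real.sqrt n))))
  ∨ K = rderiv (fStarR f a b) (β - α + zz f) * (rad Ψ P n + (β - α) / (2 * Real.sqrt n))

/-- Covering number of a (pseudo)metric space by `ε`-balls. -/
def coverNum (Θ : Type*) [PseudoMetricSpace Θ] (ε : ℝ) : ℝ≥0∞ :=
  ⨅ s ∈ {s : Finset Θ | ∀ θ : Θ, ∃ c ∈ s, dist θ c ≤ ε}, ((s.card : ℝ≥0∞))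

end

/-- A convex function has a subgradient at every interior point. -/
theorem ConvexOn.exists_subgradient {S : Set ℝ} {f : ℝ → ℝ} (hf : ConvexOn ℝ S f) {x : ℝ}
    (hx : x ∈ interior S) : ∃ m : ℝ, ∀ t ∈ S, f x + m * (t - x) ≤ f t := by
  refine ⟨derivWithin f (Ioi x) x, fun t ht => ?_⟩
  rcases lt_trichotomy t x with htx | rfl | htx
  · have hslope := (hf.slope_le_leftDeriv_of_mem_interior ht hx htx).trans
      (hf.leftDeriv_le_rightDeriv_of_mem_interior hx)
    rw [slope_def_field, div_le_iff₀ (sub_pos.2 htx)] at hslope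
    linarith
  · simp
  · have hslope := hf.rightDeriv_le_slope_of_mem_interior hx ht htx
    rw [slope_def_field, le_div_iff₀ (sub_pos.2 htx)] at hslope
    linarith

theorem isOpen_Dom (a : ℝ) (b : EReal) : IsOpen (Dom a b) :=
  isOpen_Ioi.inter (isOpen_Iio.preimage continuous_coe_real_ereal)

theorem coe_sub_le_fStar {f : ℝ → ℝ} {a : ℝ} {b : EReal} {t : ℝ} (ht : t ∈ Dom a b) (z : ℝ) :
    ((z * t - f t : ℝ) : EReal) ≤ fStar f a b z :=
  le_iSup₂ (f := fun t (_ : t ∈ Dom a b) => ((z * t - f t : ℝ) : EReal)) t ht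

theorem monotone_fStar (f : ℝ → ℝ) {a : ℝ} (ha : 0 ≤ a) (b : EReal) : Monotone (fStar f a b) := by
  intro z w hzw
  refine iSup₂_mono fun t ht => ?_
  have := mul_le_mul_of_nonneg_right hzw (ha.trans ht.1.le)
  exact_mod_cast sub_le_sub_right this (f t)

/-- The Legendre transform of a function vanishing at `1` dominates the identity. -/
theorem coe_le_fStar {f : ℝ → ℝ} {a : ℝ} {b : EReal} (h1 : 1 ∈ Dom a b) (hf1 : f 1 = 0) (z : ℝ) :
    (z : EReal) ≤ fStar f a b z := by
  simpa [hf1] using coe_sub_le_fStar (f := f) h1 z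

theorem fStar_le_of_subgradient {f : ℝ → ℝ} {a : ℝ} {b : EReal} {m : ℝ}
    (hm : ∀ t ∈ Dom a b, m * (t - 1) ≤ f t) : fStar f a b m ≤ m := by
  refine iSup₂_le fun t ht => ?_
  have := hm t ht
  exact_mod_cast (by linarith : m * t - f t ≤ m)

theorem coe_integral_le_eIntegral {X : Type*} [MeasurableSpace X] {P : Measure X} {u : X → ℝ}
    {g : X → EReal} (hu : Integrable u P) (hug : ∀ x, (u x : EReal) ≤ g x) :
    ((∫ x, u x ∂P : ℝ) : EReal) ≤ eIntegral P g := by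
  unfold eIntegral
  split_ifs with hg
  · refine EReal.coe_le_coe_iff.2 (integral_mono_ae hu hg.2 ?_)
    filter_upwards [hg.1] with x hx
    simpa using EReal.toReal_le_toReal (hug x) (EReal.coe_ne_bot _) hx
  · exact le_top

theorem eIntegral_le_coe {X : Type*} [MeasurableSpace X] {P : Measure X} [IsProbabilityMeasure P]
    {g : X → EReal} (hg : Measurable g) {l m : ℝ} (hl : ∀ x, (l : EReal) ≤ g x)
    (hm : ∀ x, g x ≤ m) : eIntegral P g ≤ m := by
  have htop (x : X) : g x ≠ ⊤ := ((hm x).trans_lt (EReal.coe_lt_top m)).ne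
  have hbot (x : X) : g x ≠ ⊥ := ((EReal.bot_lt_coe l).trans_le (hl x)).ne'
  have hlo (x : X) : l ≤ (g x).toReal := by
    simpa using EReal.toReal_le_toReal (hl x) (EReal.coe_ne_bot _) (htop x)
  have hhi (x : X) : (g x).toReal ≤ m := by
    simpa using EReal.toReal_le_toReal (hm x) (hbot x) (EReal.coe_ne_top _)
  have hint : Integrable (fun x => (g x).toReal) P :=
    Integrable.of_mem_Icc l m hg.ereal_toReal.aemeasurable (ae_of_all _ fun x => ⟨hlo x, hhi x⟩)
  unfold eIntegral
  rw [if_pos ⟨ae_of_all _ htop, hint⟩, EReal.coe_le_coe_iff]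
  simpa using integral_mono hint (integrable_const m) hhi

/-- Bounds on the generalized cumulant generating function:
if `α ≤ h ≤ β` then `α ≤ Λ_f^P[h] ≤ β`. -/
theorem stmt0 {X : Type*} [MeasurableSpace X]
    (f : ℝ → ℝ) (a : ℝ) (b : EReal) (α β : ℝ)
    (ha0 : 0 ≤ a) (ha1 : a < 1) (hb1 : ((1 : ℝ) : EReal) < b)
    (hconv : ConvexOn ℝ (Dom a b) f) (hf1 : f 1 = 0)
    (P : MeasureTheory.Measure X) [MeasureTheory.IsProbabilityMeasure P]
    (h : X → ℝ) (hmeas : Measurable h) (hαβ : α ≤ β) (hbd : ∀ x, h x ∈ Set.Icc α β) :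
    (α : EReal) ≤ cgf f a b P h ∧ cgf f a b P h ≤ (β : EReal) := by
  have h1 : (1 : ℝ) ∈ Dom a b := ⟨ha1, hb1⟩
  have hint : Integrable h P :=
    Integrable.of_mem_Icc α β hmeas.aemeasurable (ae_of_all _ hbd)
  constructor
  · refine le_iInf fun ν => ?_
    have hle := coe_integral_le_eIntegral (hint.sub (integrable_const ν))
      fun x => coe_le_fStar h1 hf1 (h x - ν)
    have hα : α ≤ ∫ x, h x ∂P := by
      simpa using integral_mono (integrable_const α) hint fun x => (hbd x).1
    refine le_trans ?_ (add_le_add_right hle (ν : EReal))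
    have hsub : ∫ x, (h - fun _ => ν : X → ℝ) x ∂P = ∫ x, h x ∂P - ν := by
      simp [integral_sub hint (integrable_const ν)]
    rw [hsub]
    exact_mod_cast (by linarith : α ≤ ν + (∫ x, h x ∂P - ν))
  · obtain ⟨m, hm⟩ := hconv.exists_subgradient ((isOpen_Dom a b).interior_eq.symm ▸ h1)
    simp only [hf1, zero_add] at hm
    have hmono := monotone_fStar f ha0 b
    have hle : eIntegral P (fun x => fStar f a b (h x - (β - m))) ≤ m := by
      refine eIntegral_le_coe (l := α - (β - m))
        (hmono.measurable.comp (hmeas.sub_const _)) (fun x => ?_) fun x => ?_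
      · exact (EReal.coe_le_coe_iff.2 (sub_le_sub_right (hbd x).1 _)).trans
          (coe_le_fStar h1 hf1 _)
      · exact (hmono (by linarith [(hbd x).2])).trans (fStar_le_of_subgradient hm)
    refine (iInf_le _ (β - m)).trans ((add_le_add_right hle _).trans ?_)
    exact_mod_cast (by linarith : β - m + m ≤ β)
end

section
/- Let 0 ≤ a < 1 < b ≤ ∞ and f ∈ F₁(a,b) be strictly convex in a neighborhood of 1 with z₀ + β − α in the interior of {f* < ∞}, where z₀ := f'_+(1) and α ≤ β are real numbers. Define Λ_f : ℝⁿ → ℝ by Λ_f(x) := inf_{ν∈ℝ} { ν + (1/n) Σᵢ₌₁ⁿ f*(xᵢ − ν) }. Then for all x, x̃ ∈ [α,β]ⁿ, |Λ_f(x̃) − Λ_f(x)| ≤ (1/n) (f*)'_+(z₀ + β − α) Σᵢ₌₁ⁿ |x̃ᵢ − xᵢ|; in particular Λ_f is continuous on [α,β]ⁿ. -/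
open MeasureTheory Set Filter Topology
open scoped ENNReal NNReal Classical

/-- A convex function lies above the line through an interior point whose slope is the right
derivative there. -/
lemma ConvexOn.add_rderiv_mul_le {S : Set ℝ} {g : ℝ → ℝ} (hg : ConvexOn ℝ S g) {x y : ℝ}
    (hx : x ∈ interior S) (hy : y ∈ S) : g x + rderiv g x * (y - x) ≤ g y := by
  rw [rderiv, ← derivWithin_Ioi_eq_Ici]
  rcases lt_trichotomy x y with h | rfl | h
  · have := hg.rightDeriv_le_slope_of_mem_interior hx hy h
    rw [slope_def_field, le_div_iff₀ (sub_pos.2 h)] at this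
    linarith
  · simp
  · have := (hg.slope_le_leftDeriv_of_mem_interior hy hx h).trans
      (hg.leftDeriv_le_rightDeriv_of_mem_interior hx)
    rw [slope_def_field, div_le_iff₀ (sub_pos.2 h)] at this
    linarith

lemma one_mem_interior_Dom {a : ℝ} {b : EReal} (ha1 : a < 1) (hb1 : ((1 : ℝ) : EReal) < b) :
    (1 : ℝ) ∈ interior (Dom a b) := by
  have ho : IsOpen (Dom a b) :=
    (isOpen_lt continuous_const continuous_id).inter
      (isOpen_lt continuous_coe_real_ereal continuous_const)
  rw [ho.interior_eq]
  exact ⟨ha1, hb1⟩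

section LegendreTransform

variable {f : ℝ → ℝ} {a : ℝ} {b : EReal} {z w t : ℝ}

lemma le_fStar (ht : t ∈ Dom a b) : ((z * t - f t : ℝ) : EReal) ≤ fStar f a b z :=
  le_iSup₂ (f := fun t (_ : t ∈ Dom a b) => ((z * t - f t : ℝ) : EReal)) t ht

lemma self_le_fStar (h1 : (1 : ℝ) ∈ Dom a b) (hf1 : f 1 = 0) : (z : EReal) ≤ fStar f a b z := by
  simpa [hf1] using le_fStar (f := f) (z := z) h1

lemma coe_fStarR (h1 : (1 : ℝ) ∈ Dom a b) (hz : fStar f a b z < ⊤) :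
    (fStarR f a b z : EReal) = fStar f a b z :=
  EReal.coe_toReal hz.ne (ne_bot_of_le_ne_bot (EReal.coe_ne_bot _) (le_fStar h1))

lemma le_fStarR (h1 : (1 : ℝ) ∈ Dom a b) (hz : fStar f a b z < ⊤) (ht : t ∈ Dom a b) :
    z * t - f t ≤ fStarR f a b z := by
  rw [← EReal.coe_le_coe_iff, coe_fStarR h1 hz]
  exact le_fStar ht

lemma fStarR_le (h1 : (1 : ℝ) ∈ Dom a b) (hz : fStar f a b z < ⊤) {c : ℝ}
    (h : ∀ t ∈ Dom a b, z * t - f t ≤ c) : fStarR f a b z ≤ c := by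
  rw [← EReal.coe_le_coe_iff, coe_fStarR h1 hz]
  exact iSup₂_le fun t ht => EReal.coe_le_coe_iff.2 (h t ht)

lemma fStar_mono (ha0 : 0 ≤ a) : Monotone (fStar f a b) := fun _ _ hzw =>
  iSup₂_le fun _ ht => le_trans
    (EReal.coe_le_coe_iff.2
      (sub_le_sub_right (mul_le_mul_of_nonneg_right hzw (ha0.trans ht.1.le)) _))
    (le_fStar ht)

lemma fStar_lt_top_of_le (ha0 : 0 ≤ a) (hw : w ∈ interior {z : ℝ | fStar f a b z < ⊤})
    (hzw : z ≤ w) : fStar f a b z < ⊤ :=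
  (fStar_mono ha0 hzw).trans_lt (show w ∈ {z : ℝ | fStar f a b z < ⊤} from interior_subset hw)

lemma convexOn_fStarR (h1 : (1 : ℝ) ∈ Dom a b) (ha0 : 0 ≤ a) :
    ConvexOn ℝ {z : ℝ | fStar f a b z < ⊤} (fStarR f a b) := by
  have hS : Convex ℝ {z : ℝ | fStar f a b z < ⊤} :=
    OrdConnected.convex (isLowerSet_iff_forall_lt.2 fun z w hwz hz =>
      lt_of_le_of_lt (fStar_mono ha0 hwz.le) hz).ordConnected
  refine ⟨hS, fun z hz w hw p q hp hq hpq => fStarR_le h1 (hS hz hw hp hq hpq) fun t ht => ?_⟩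
  have hzt := mul_le_mul_of_nonneg_left (le_fStarR h1 hz ht) hp
  have hwt := mul_le_mul_of_nonneg_left (le_fStarR h1 hw ht) hq
  obtain rfl : q = 1 - p := by linarith
  simp only [smul_eq_mul]
  linarith

/-- The function `z ↦ f*(z) - z` is nondecreasing on `[f'_+(1), ∞)`. -/
lemma fStar_add_sub_le (h1 : (1 : ℝ) ∈ interior (Dom a b)) (hconv : ConvexOn ℝ (Dom a b) f)
    (hf1 : f 1 = 0) (hz : fStar f a b z < ⊤) (hz0 : zz f ≤ z) (hzw : z ≤ w) :
    ((fStarR f a b z + (w - z) : ℝ) : EReal) ≤ fStar f a b w := by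
  have h1' := interior_subset h1
  rcases eq_or_ne (fStar f a b w) ⊤ with hw | hw
  · simp [hw]
  have hw := lt_top_iff_ne_top.2 hw
  rw [← coe_fStarR h1' hw, EReal.coe_le_coe_iff, ← le_sub_iff_add_le]
  refine fStarR_le h1' hz fun t ht => ?_
  rcases le_total 1 t with h | h
  · nlinarith [le_fStarR h1' hw ht]
  · have h2 := le_fStarR h1' hw h1'
    have h3 := hconv.add_rderiv_mul_le h1 ht
    rw [hf1] at h2 h3
    rw [zz] at hz0
    nlinarith

/-- The right derivative of `f*` at `w` is a Lipschitz constant for `f*` on `(-∞, w]`. -/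
lemma fStarR_sub_le (h1 : (1 : ℝ) ∈ Dom a b) (ha0 : 0 ≤ a)
    (hw : w ∈ interior {z : ℝ | fStar f a b z < ⊤}) {u v : ℝ} (hu : u ≤ w) (hv : v ≤ w) :
    fStarR f a b v - fStarR f a b u ≤ rderiv (fStarR f a b) w * |v - u| := by
  have hc := convexOn_fStarR (f := f) (b := b) h1 ha0
  have hfin : ∀ {z}, z ≤ w → fStar f a b z < ⊤ := fStar_lt_top_of_le ha0 hw
  have hmono : ∀ {y z}, y ≤ z → z ≤ w → fStarR f a b y ≤ fStarR f a b z := fun hyz hz =>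
    EReal.toReal_le_toReal (fStar_mono ha0 hyz)
      (ne_bot_of_le_ne_bot (EReal.coe_ne_bot _) (le_fStar h1)) (hfin hz).ne
  have hL : 0 ≤ rderiv (fStarR f a b) w := by
    have h2 := hc.add_rderiv_mul_le hw (hfin (sub_one_lt w).le)
    have h3 := hmono (sub_one_lt w).le le_rfl
    linarith
  rcases le_or_gt v u with h | h
  · have := mul_nonneg hL (abs_nonneg (v - u))
    linarith [hmono h hu]
  · have h2 := hc.add_rderiv_mul_le hw (hfin hu)
    have h3 := hc.secant_mono (hfin hu) (hfin hv) (hfin le_rfl) h.ne' (h.trans_le hv).ne' hv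
    rw [abs_of_pos (sub_pos.2 h), ← div_le_iff₀ (sub_pos.2 h)]
    refine h3.trans ((div_le_iff₀ (sub_pos.2 (h.trans_le hv))).2 ?_)
    linarith

end LegendreTransform

section LamVec

variable {f : ℝ → ℝ} {a : ℝ} {b : EReal} {n : ℕ}

lemma coe_sum_fin_ereal (g : Fin n → ℝ) : ((∑ i, g i : ℝ) : EReal) = ∑ i, (g i : EReal) :=
  map_sum (⟨⟨Real.toEReal, EReal.coe_zero⟩, EReal.coe_add⟩ : ℝ →+ EReal) g Finset.univ

lemma add_inv_mul_sum_mono {g : Fin n → ℝ} {G : Fin n → EReal} (h : ∀ i, (g i : EReal) ≤ G i)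
    (ν : ℝ) : ((ν + (n : ℝ)⁻¹ * ∑ i, g i : ℝ) : EReal) ≤
      (ν : EReal) + ((n : ℝ)⁻¹ : EReal) * ∑ i, G i := by
  have hn : ((n : ℝ)⁻¹ : EReal) = (((n : ℝ)⁻¹ : ℝ) : EReal) := (EReal.coe_inv _).symm
  rw [hn, EReal.coe_add, EReal.coe_mul, coe_sum_fin_ereal]
  exact add_le_add_right (mul_le_mul_of_nonneg_left (Finset.sum_le_sum fun i _ => h i)
    (EReal.coe_nonneg.2 (by positivity))) _

lemma lamVec_le {x : Fin n → ℝ} {ν : ℝ} (h1 : (1 : ℝ) ∈ Dom a b)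
    (h : ∀ i, fStar f a b (x i - ν) < ⊤) :
    lamVec f a b x ≤ ((ν + (n : ℝ)⁻¹ * ∑ i, fStarR f a b (x i - ν) : ℝ) : EReal) := by
  refine (iInf_le _ ν).trans_eq ?_
  have hn : ((n : ℝ)⁻¹ : EReal) = (((n : ℝ)⁻¹ : ℝ) : EReal) := (EReal.coe_inv _).symm
  rw [hn, EReal.coe_add, EReal.coe_mul, coe_sum_fin_ereal]
  simp only [fun i => coe_fStarR h1 (h i)]

lemma mean_le_lamVec (h1 : (1 : ℝ) ∈ Dom a b) (hf1 : f 1 = 0) (hn : 0 < n) (x : Fin n → ℝ) :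
    (((n : ℝ)⁻¹ * ∑ i, x i : ℝ) : EReal) ≤ lamVec f a b x := by
  refine le_iInf fun ν => le_trans (le_of_eq ?_)
    (add_inv_mul_sum_mono (fun i => self_le_fStar (f := f) (z := x i - ν) h1 hf1) ν)
  have : (n : ℝ) ≠ 0 := by positivity
  congr 1
  simp only [Finset.sum_sub_distrib, Finset.sum_const, Finset.card_univ, Fintype.card_fin,
    nsmul_eq_mul]
  field_simp
  ring

/-- The infimum defining `Λ_f(x)` may be restricted to `ν ≥ α - z₀`. -/
lemma le_lamVec (h1 : (1 : ℝ) ∈ interior (Dom a b)) (hconv : ConvexOn ℝ (Dom a b) f)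
    (hf1 : f 1 = 0) (hn : 0 < n) {α : ℝ} {x : Fin n → ℝ} (hx : ∀ i, α ≤ x i)
    (hfin : ∀ ν, α - zz f ≤ ν → ∀ i, fStar f a b (x i - ν) < ⊤) {c : ℝ}
    (hc : ∀ ν, α - zz f ≤ ν → c ≤ ν + (n : ℝ)⁻¹ * ∑ i, fStarR f a b (x i - ν)) :
    (c : EReal) ≤ lamVec f a b x := by
  refine le_iInf fun ν => ?_
  rcases le_total (α - zz f) ν with h | h
  · exact (EReal.coe_le_coe_iff.2 (hc ν h)).trans
      (add_inv_mul_sum_mono (fun i => (coe_fStarR (interior_subset h1) (hfin ν h i)).le) ν)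
  · refine le_trans (EReal.coe_le_coe_iff.2 ((hc _ le_rfl).trans_eq ?_))
      (add_inv_mul_sum_mono (fun i => fStar_add_sub_le h1 hconv hf1 (hfin _ le_rfl i)
        (by linarith [hx i]) (sub_le_sub_left h (x i))) ν)
    have : (n : ℝ) ≠ 0 := by positivity
    simp only [sub_sub_sub_cancel_left, Finset.sum_add_distrib, Finset.sum_const,
      Finset.card_univ, Fintype.card_fin, nsmul_eq_mul]
    field_simp
    ring

end LamVec

/-- Lipschitz bound for `Λ_f : ℝⁿ → ℝ`, and in particular
its continuity on `[α,β]ⁿ`. -/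
theorem stmt3 (f : ℝ → ℝ) (a : ℝ) (b : EReal) (α β : ℝ)
    (ha0 : 0 ≤ a) (ha1 : a < 1) (hb1 : ((1 : ℝ) : EReal) < b)
    (hconv : ConvexOn ℝ (Dom a b) f) (hf1 : f 1 = 0)
    (hstrict : ∃ ε > 0, Set.Ioo (1 - ε) (1 + ε) ⊆ Dom a b ∧
      StrictConvexOn ℝ (Set.Ioo (1 - ε) (1 + ε)) f)
    (hz : zz f + β - α ∈ interior {z : ℝ | fStar f a b z < ⊤})
    (hαβ : α ≤ β) (n : ℕ) (hn : 0 < n) :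
    (∀ x xt : Fin n → ℝ, (∀ i, x i ∈ Set.Icc α β) → (∀ i, xt i ∈ Set.Icc α β) →
      |(lamVec f a b xt).toReal - (lamVec f a b x).toReal| ≤
        (n : ℝ)⁻¹ * rderiv (fStarR f a b) (zz f + β - α) * ∑ i, |xt i - x i|) ∧
    ContinuousOn (fun x : Fin n → ℝ => (lamVec f a b x).toReal)
      {x : Fin n → ℝ | ∀ i, x i ∈ Set.Icc α β} := by

  have h1 := one_mem_interior_Dom ha1 hb1
  have h1' := interior_subset h1
  have hfin : ∀ x : Fin n → ℝ, (∀ i, x i ∈ Set.Icc α β) → ∀ ν, α - zz f ≤ ν →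
      ∀ i, fStar f a b (x i - ν) < ⊤ := fun x hx ν hν i =>
    fStar_lt_top_of_le ha0 hz (by linarith [(hx i).2])
  have hcoe : ∀ x : Fin n → ℝ, (∀ i, x i ∈ Set.Icc α β) →
      ((lamVec f a b x).toReal : EReal) = lamVec f a b x := fun x hx =>
    EReal.coe_toReal
      (ne_top_of_le_ne_top (EReal.coe_ne_top _) (lamVec_le h1' (hfin x hx _ le_rfl)))
      (ne_bot_of_le_ne_bot (EReal.coe_ne_bot _) (mean_le_lamVec h1' hf1 hn x))
  have hle : ∀ x xt : Fin n → ℝ, (∀ i, x i ∈ Set.Icc α β) → (∀ i, xt i ∈ Set.Icc α β) →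
      (lamVec f a b xt).toReal - (lamVec f a b x).toReal ≤
        (n : ℝ)⁻¹ * rderiv (fStarR f a b) (zz f + β - α) * ∑ i, |xt i - x i| := by
    intro x xt hx hxt
    rw [sub_le_comm, ← EReal.coe_le_coe_iff, hcoe x hx]
    refine le_lamVec h1 hconv hf1 hn (fun i => (hx i).1) (hfin x hx) fun ν hν => ?_
    have h2 := lamVec_le h1' (hfin xt hxt ν hν)
    rw [← hcoe xt hxt, EReal.coe_le_coe_iff] at h2
    have h3 : ∑ i, (fStarR f a b (xt i - ν) - fStarR f a b (x i - ν)) ≤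
        ∑ i, rderiv (fStarR f a b) (zz f + β - α) * |xt i - x i| := by
      refine Finset.sum_le_sum fun i _ => ?_
      have := fStarR_sub_le h1' ha0 hz (u := x i - ν) (v := xt i - ν)
        (by linarith [(hx i).2]) (by linarith [(hxt i).2])
      rwa [sub_sub_sub_cancel_right] at this
    rw [Finset.sum_sub_distrib, ← Finset.mul_sum] at h3
    have h4 := mul_le_mul_of_nonneg_left h3 (by positivity : (0 : ℝ) ≤ (n : ℝ)⁻¹)
    linarith
  have habs : ∀ x xt : Fin n → ℝ, (∀ i, x i ∈ Set.Icc α β) → (∀ i, xt i ∈ Set.Icc α β) →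
      |(lamVec f a b xt).toReal - (lamVec f a b x).toReal| ≤
        (n : ℝ)⁻¹ * rderiv (fStarR f a b) (zz f + β - α) * ∑ i, |xt i - x i| := by
    refine fun x xt hx hxt => abs_sub_le_iff.2 ⟨hle x xt hx hxt, ?_⟩
    simpa only [abs_sub_comm] using hle xt x hxt hx
  refine ⟨habs, fun x hx => ?_⟩
  refine tendsto_iff_dist_tendsto_zero.2 (squeeze_zero' (Eventually.of_forall fun _ => dist_nonneg)
    (eventually_mem_nhdsWithin.mono fun xt hxt => habs x xt hx hxt) ?_)
  have hcont : Continuous fun xt : Fin n → ℝ =>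
      (n : ℝ)⁻¹ * rderiv (fStarR f a b) (zz f + β - α) * ∑ i, |xt i - x i| := by fun_prop
  simpa using (hcont.tendsto x).mono_left nhdsWithin_le_nhds
end
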